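/- Let 𝒪 ⊂ ℝ^{m−1} × ℝ^n be open, A ∈ 𝒪, j ∈ {2,…,m}, δ > 0 and ψ : 𝒪 → ℝ. Let γ : [−δ,δ] → 𝒪 be a C¹ curve with components (γ₂,…,γ_m, γ_{y,1},…,γ_{y,n}) such that γ(0) = A, γ_h'(t) = 1 if h = j and γ_h'(t) = 0 for h ∈ {2,…,m}∖{j}, and γ_{y,s}'(t) = ψ(γ(t))·b^s_{j1} + ½·Σ_{l=2}^m γ_l(t)·b^s_{jl} for s = 1,…,n (i.e. γ is an integral curve of the vector field D_j^ψ). Assume ψ is uniformly intrinsically differentiable at A with intrinsic gradient ∇^ψψ(A) ∈ ℝ^{m−1}, and that t ↦ ψ(γ(t)) belongs to C¹([−δ,δ]). Then lim_{t→0} (ψ(γ(t)) − ψ(A))/t = (∇^ψψ(A))_j (the component of ∇^ψψ(A) corresponding to x_j). -/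

import Mathlib

noncomputable section

open Set Filter Topology MeasureTheory

namespace Carnot

/-- Euclidean norm on `Fin d → ℝ`. -/
def enorm {d : ℕ} (x : Fin d → ℝ) : ℝ := Real.sqrt (∑ i, (x i) ^ 2)

/-- The underlying set of the Carnot group `G = ℝ^m × ℝ^n` of class `𝓑`. -/
abbrev G (m n : ℕ) := (Fin m → ℝ) × (Fin n → ℝ)

/-- Points of the normal complement `W`, identified with `ℝ^(m-k) × ℝ^n`. -/
abbrev W (m n k : ℕ) := (Fin (m - k) → ℝ) × (Fin n → ℝ)

/-- The group law of the Carnot group of class `𝓑` associated with the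
skew-symmetric matrices `b s`:
`(x,y)·(x',y') = (x + x', y + y' + ½⟨Bx,x'⟩)`. -/
def gmul {m n : ℕ} (b : Fin n → Matrix (Fin m) (Fin m) ℝ) (P Q : G m n) : G m n :=
  (P.1 + Q.1, fun s => P.2 s + Q.2 s + (1 / 2) * ∑ i, ∑ j, b s i j * P.1 j * Q.1 i)

/-- The group inverse `(x,y)⁻¹ = (-x,-y)`. -/
def ginv {m n : ℕ} (P : G m n) : G m n := (-P.1, -P.2)

/-- The homogeneous quasi-norm `N(x,y) = |x| + |y|^(1/2)`. -/
def qnorm {m n : ℕ} (P : G m n) : ℝ := enorm P.1 + Real.sqrt (enorm P.2)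

/-- Open ball for the quasi-norm: `U(P,r) = {Q : N(P⁻¹·Q) < r}`. -/
def ball (m n : ℕ) (b : Fin n → Matrix (Fin m) (Fin m) ℝ) (P : G m n) (r : ℝ) : Set (G m n) :=
  {Q | qnorm (gmul b (ginv P) Q) < r}

/-- The embedding `i : ℝ^(m-k) × ℝ^n → G`, `i(a,α) = (0,…,0,a,α)`. -/
def embW (m n k : ℕ) (A : W m n k) : G m n :=
  (fun j => if h : (j : ℕ) < k then 0 else A.1 ⟨(j : ℕ) - k, by have := j.isLt; omega⟩, A.2)

/-- The embedding of `ℝ^k` as the horizontal subgroup `H`, `v ↦ (v,0,…,0)`. -/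
def embH (m n k : ℕ) (v : Fin k → ℝ) : G m n :=
  (fun j => if h : (j : ℕ) < k then v ⟨(j : ℕ), h⟩ else 0, 0)

/-- The graph map `Φ(A) = i(A)·φ̂(A)`. -/
def graphMap (m n k : ℕ) (b : Fin n → Matrix (Fin m) (Fin m) ℝ)
    (φ : W m n k → Fin k → ℝ) (A : W m n k) : G m n :=
  gmul b (embW m n k A) (embH m n k (φ A))

/-- `N(i(A)⁻¹·i(B))`. -/
def dW (m n k : ℕ) (b : Fin n → Matrix (Fin m) (Fin m) ℝ) (A B : W m n k) : ℝ :=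
  qnorm (gmul b (ginv (embW m n k A)) (embW m n k B))

/-- The graph quasi-distance `σ_φ(A,B) = N(φ̂(A)⁻¹·i(A)⁻¹·i(B)·φ̂(A))`. -/
def sigma (m n k : ℕ) (b : Fin n → Matrix (Fin m) (Fin m) ℝ)
    (φ : W m n k → Fin k → ℝ) (A B : W m n k) : ℝ :=
  qnorm (gmul b (gmul b (gmul b (ginv (embH m n k (φ A))) (ginv (embW m n k A)))
    (embW m n k B)) (embH m n k (φ A)))

/-- The matrix `M` satisfies the uniform intrinsic differentiability condition of `φ`
at `A₀ ∈ 𝒪`. -/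
def UID (m n k : ℕ) (b : Fin n → Matrix (Fin m) (Fin m) ℝ) (O : Set (W m n k))
    (φ : W m n k → Fin k → ℝ) (A₀ : W m n k) (M : Matrix (Fin k) (Fin (m - k)) ℝ) : Prop :=
  ∀ ε > 0, ∃ r > 0, ∀ A ∈ O, ∀ B ∈ O,
    dW m n k b A₀ A < r → dW m n k b A B < r → 0 < dW m n k b A B →
    enorm (fun j => φ B j - φ A j - ∑ i, M j i * (B.1 i - A.1 i)) ≤ ε * sigma m n k b φ A B

/-- `f : U → ℝ^k` is of class `C¹_G` with (continuous) horizontal Jacobian `gradf`. -/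
def C1G (m n k : ℕ) (b : Fin n → Matrix (Fin m) (Fin m) ℝ) (U : Set (G m n))
    (f : G m n → Fin k → ℝ) (gradf : G m n → Matrix (Fin k) (Fin m) ℝ) : Prop :=
  ContinuousOn f U ∧ ContinuousOn gradf U ∧
  ∀ P ∈ U, ∀ ε > 0, ∃ r > 0, ∀ Q ∈ U,
    qnorm (gmul b (ginv P) Q) < r →
    enorm (fun j => f Q j - f P j - ∑ i, gradf P j i * (Q.1 i - P.1 i)) ≤
      ε * qnorm (gmul b (ginv P) Q)

/-- The square block `M₁(Q) = (X_i f_j(Q))_{j,i=1,…,k}` of the horizontal Jacobian. -/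
def M1 (m n k : ℕ) (hk : k ≤ m) (gradf : G m n → Matrix (Fin k) (Fin m) ℝ) (Q : G m n) :
    Matrix (Fin k) (Fin k) ℝ :=
  Matrix.of fun j i => gradf Q j (Fin.castLE hk i)

/-- The block `M₂(Q) = (X_{k+i} f_j(Q))_{j=1,…,k; i=1,…,m-k}` of the horizontal Jacobian. -/
def M2 (m n k : ℕ) (gradf : G m n → Matrix (Fin k) (Fin m) ℝ) (Q : G m n) :
    Matrix (Fin k) (Fin (m - k)) ℝ :=
  Matrix.of fun j i => gradf Q j ⟨k + (i : ℕ), by have := i.isLt; omega⟩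

/-! ### The codimension-one case `k = 1` -/

/-- The index of the variable `x_{j+1}`, `j ∈ {2,…,m}`, inside `Fin m`
(recall that points of `ℝ^{m-1} × ℝ^n` are written `(x₂,…,x_m,y₁,…,y_n)`). -/
def idx1 (m : ℕ) (i : Fin (m - 1)) : Fin m := ⟨(i : ℕ) + 1, by have := i.isLt; omega⟩

/-- Scalar version of `C1G`: `f : U → ℝ` of class `C¹_G` with horizontal
gradient `∇_G f = (X₁f,…,X_mf)`. -/
def C1Gs (m n : ℕ) (b : Fin n → Matrix (Fin m) (Fin m) ℝ) (U : Set (G m n))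
    (f : G m n → ℝ) (gradf : G m n → Fin m → ℝ) : Prop :=
  ContinuousOn f U ∧ ContinuousOn gradf U ∧
  ∀ P ∈ U, ∀ ε > 0, ∃ r > 0, ∀ Q ∈ U,
    qnorm (gmul b (ginv P) Q) < r →
    |f Q - f P - ∑ i, gradf P i * (Q.1 i - P.1 i)| ≤ ε * qnorm (gmul b (ginv P) Q)

/-- `ψ : 𝒪 → ℝ` is uniformly intrinsically differentiable at `A₀` with intrinsic
gradient `g ∈ ℝ^{m-1}` (scalar version of `UID`). -/
def UIDs (m n : ℕ) (b : Fin n → Matrix (Fin m) (Fin m) ℝ) (O : Set (W m n 1))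
    (ψ : W m n 1 → ℝ) (A₀ : W m n 1) (g : Fin (m - 1) → ℝ) : Prop :=
  ∀ ε > 0, ∃ r > 0, ∀ A ∈ O, ∀ B ∈ O,
    dW m n 1 b A₀ A < r → dW m n 1 b A B < r → 0 < dW m n 1 b A B →
    |ψ B - ψ A - ∑ i, g i * (B.1 i - A.1 i)| ≤
      ε * sigma m n 1 b (fun A' _ => ψ A') A B

/-- The graph map `Φ(A) = i(A)·ψ̂(A)` for a scalar `ψ`. -/
def graphMapS (m n : ℕ) (b : Fin n → Matrix (Fin m) (Fin m) ℝ)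
    (ψ : W m n 1 → ℝ) (A : W m n 1) : G m n :=
  graphMap m n 1 b (fun A' _ => ψ A') A

/-- The intrinsic derivative `D_j^ψ ψ` of a (C¹) function `ψ : ℝ^{m-1} × ℝ^n → ℝ`:
`D_j^ψψ = ∂_{x_j}ψ + Σ_s (ψ b^s_{j1} + ½ Σ_l x_l b^s_{jl}) ∂_{y_s}ψ`. -/
def Dj (m n : ℕ) (h0 : 0 < m) (b : Fin n → Matrix (Fin m) (Fin m) ℝ)
    (ψ : W m n 1 → ℝ) (j : Fin (m - 1)) (A : W m n 1) : ℝ :=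
  fderiv ℝ ψ A ((Pi.single j 1 : Fin (m - 1) → ℝ), (0 : Fin n → ℝ)) +
    ∑ s, (ψ A * b s (idx1 m j) ⟨0, h0⟩ +
        (1 / 2) * ∑ l, A.1 l * b s (idx1 m j) (idx1 m l)) *
      fderiv ℝ ψ A ((0 : Fin (m - 1) → ℝ), (Pi.single s 1 : Fin n → ℝ))

/-- Euclidean norm on `ℝ^d × ℝ^e`. -/
def enormP {d e : ℕ} (P : (Fin d → ℝ) × (Fin e → ℝ)) : ℝ :=
  Real.sqrt (∑ i, (P.1 i) ^ 2 + ∑ s, (P.2 s) ^ 2)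

/-- Closed Euclidean ball in `ℝ^d × ℝ^e`. -/
def cballE {d e : ℕ} (A : (Fin d → ℝ) × (Fin e → ℝ)) (r : ℝ) :
    Set ((Fin d → ℝ) × (Fin e → ℝ)) :=
  {B | enormP (B - A) ≤ r}

/-- `ψ` is a broad* solution of `(D₂^ψψ,…,D_m^ψψ) = w` in `𝒪`: around every point
there are exponential maps of the vector fields `D_j^ψ` along which `ψ(γ(t)) − ψ(γ(0))`
is the integral of `w_j ∘ γ`. -/
def IsBroadStar (m n : ℕ) (h0 : 0 < m) (b : Fin n → Matrix (Fin m) (Fin m) ℝ)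
    (O : Set (W m n 1)) (ψ : W m n 1 → ℝ) (w : W m n 1 → Fin (m - 1) → ℝ) : Prop :=
  ∀ A ∈ O, ∃ δ₁ δ₂ : ℝ, 0 < δ₂ ∧ δ₂ < δ₁ ∧ cballE A δ₁ ⊆ O ∧
    ∀ j : Fin (m - 1), ∃ γ : ℝ → W m n 1 → W m n 1,
      ∀ B ∈ cballE A δ₂,
        (∀ t ∈ Set.Icc (-δ₂) δ₂, γ t B ∈ cballE A δ₁) ∧
        γ 0 B = B ∧
        (∀ h : Fin (m - 1), ∀ t ∈ Set.Icc (-δ₂) δ₂,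
          HasDerivAt (fun t' => (γ t' B).1 h) (if h = j then 1 else 0) t) ∧
        (∀ s : Fin n, ∀ t ∈ Set.Icc (-δ₂) δ₂,
          HasDerivAt (fun t' => (γ t' B).2 s)
            (ψ (γ t B) * b s (idx1 m j) ⟨0, h0⟩ +
              (1 / 2) * ∑ l, (γ t B).1 l * b s (idx1 m j) (idx1 m l)) t) ∧
        (∀ t ∈ Set.Icc (-δ₂) δ₂, ψ (γ t B) - ψ B = ∫ r in (0:ℝ)..t, w (γ r B) j)

theorem enorm_le_sum_abs {d : ℕ} (x : Fin d → ℝ) : enorm x ≤ ∑ i, |x i| := by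
  refine Real.sqrt_le_iff.mpr ⟨Finset.sum_nonneg fun i _ => abs_nonneg _, ?_⟩
  simpa only [sq_abs] using
    Finset.sum_sq_le_sq_sum_of_nonneg (s := Finset.univ) (f := fun i => |x i|)
      fun i _ => abs_nonneg _

theorem enorm_single {d : ℕ} (i : Fin d) (t : ℝ) : enorm (Pi.single i t) = |t| := by
  have h : ∑ k, (Pi.single i t : Fin d → ℝ) k ^ 2 = t ^ 2 := by
    rw [Finset.sum_eq_single i] <;> simp +contextual
  rw [enorm, h, Real.sqrt_sq_eq_abs]

theorem continuous_enorm {d : ℕ} : Continuous (enorm : (Fin d → ℝ) → ℝ) := by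
  unfold enorm
  fun_prop

/-- The bilinear term of the group law, in matrix notation. -/
theorem gmul_eq {m n : ℕ} (b : Fin n → Matrix (Fin m) (Fin m) ℝ) (P Q : G m n) :
    gmul b P Q =
      (P.1 + Q.1, fun s => P.2 s + Q.2 s + (1 / 2) * (Q.1 ⬝ᵥ (b s).mulVec P.1)) := by
  refine Prod.ext rfl (funext fun s => ?_)
  simp only [gmul, dotProduct, Matrix.mulVec, Finset.mul_sum]
  congr 1
  exact Finset.sum_congr rfl fun i _ => Finset.sum_congr rfl fun k _ => by ring

theorem dotProduct_mulVec_comm_of_skew {d : ℕ} {M : Matrix (Fin d) (Fin d) ℝ}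
    (hM : M.transpose = -M) (p q : Fin d → ℝ) :
    p ⬝ᵥ M.mulVec q = -(q ⬝ᵥ M.mulVec p) := by
  rw [Matrix.dotProduct_mulVec, ← Matrix.mulVec_transpose, hM, Matrix.neg_mulVec,
    neg_dotProduct, dotProduct_comm]

theorem embW_fst_eq_add_single {m n : ℕ} {A B : W m n 1} {j : Fin (m - 1)} {t : ℝ}
    (hB : B.1 = A.1 + Pi.single j t) :
    (embW m n 1 B).1 = (embW m n 1 A).1 + Pi.single (idx1 m j) t := by
  funext i
  by_cases h : (i : ℕ) < 1
  · have hi : i ≠ idx1 m j := by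
      intro h'
      simp [h', idx1] at h
    simp only [embW, h, Pi.add_apply, Pi.single_eq_of_ne hi, dite_true, add_zero]
  · have hi : (⟨(i : ℕ) - 1, by omega⟩ : Fin (m - 1)) = j ↔ i = idx1 m j := by
      simp only [Fin.ext_iff, idx1]
      omega
    simp only [embW, h, hB, Pi.add_apply, Pi.single_apply, hi, dite_false]

theorem embH_fst_eq_single {m n : ℕ} (h0 : 0 < m) (c : ℝ) :
    (embH m n 1 fun _ => c).1 = Pi.single ⟨0, h0⟩ c := by
  funext i
  simp [embH, Pi.single_apply, Fin.ext_iff]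

theorem mulVec_embW_apply {m n : ℕ} (M : Matrix (Fin m) (Fin m) ℝ) (A : W m n 1) (i : Fin m) :
    M.mulVec (embW m n 1 A).1 i = ∑ l, A.1 l * M i (idx1 m l) := by
  obtain _ | k := m
  · exact i.elim0
  · have hzero : (embW (k + 1) n 1 A).1 0 = 0 := by simp [embW]
    have hsucc (l : Fin k) : (embW (k + 1) n 1 A).1 l.succ = A.1 l := by
      simp only [embW, Fin.val_succ]
      exact dif_neg (by omega)
    rw [Matrix.mulVec, dotProduct, Fin.sum_univ_succ, hzero, mul_zero, zero_add]
    exact Finset.sum_congr rfl fun l _ => by rw [hsucc, mul_comm]; rfl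

/-- The graph quasi-distance between points differing horizontally only in the direction `j`. -/
theorem sigma_of_eq_add_single {m n : ℕ} (h0 : 0 < m) (b : Fin n → Matrix (Fin m) (Fin m) ℝ)
    (hskew : ∀ s, (b s).transpose = -(b s)) (ψ : W m n 1 → ℝ) {A B : W m n 1}
    {j : Fin (m - 1)} {t : ℝ} (hB : B.1 = A.1 + Pi.single j t) :
    sigma m n 1 b (fun A' _ => ψ A') A B =
      |t| + Real.sqrt (enorm fun s => B.2 s - A.2 s -
        t * (ψ A * b s (idx1 m j) ⟨0, h0⟩ +
          (1 / 2) * ∑ l, A.1 l * b s (idx1 m j) (idx1 m l))) := by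
  simp only [sigma, qnorm, gmul_eq, ginv]
  congr 2
  · rw [← enorm_single (idx1 m j) t, embW_fst_eq_add_single hB]
    congr 1
    abel
  · congr 1
    funext s
    have hself (p : Fin m → ℝ) : p ⬝ᵥ (b s).mulVec p = 0 := by
      linarith [dotProduct_mulVec_comm_of_skew (hskew s) p p]
    rw [embW_fst_eq_add_single hB, embH_fst_eq_single h0, ← mulVec_embW_apply]
    set a := (embW m n 1 A).1
    have hea := dotProduct_mulVec_comm_of_skew (hskew s) (Pi.single ⟨0, h0⟩ (ψ A)) a
    have hee := dotProduct_mulVec_comm_of_skew (hskew s) (Pi.single ⟨0, h0⟩ (ψ A))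
      (Pi.single (idx1 m j) t)
    have hv : Pi.single (idx1 m j) t ⬝ᵥ (b s).mulVec (Pi.single ⟨0, h0⟩ (ψ A)) =
        t * (ψ A * b s (idx1 m j) ⟨0, h0⟩) := by
      simp [single_dotProduct, mul_left_comm]
    have ha : Pi.single (idx1 m j) t ⬝ᵥ (b s).mulVec a = t * (b s).mulVec a (idx1 m j) := by
      simp [single_dotProduct]
    simp only [Matrix.mulVec_add, Matrix.mulVec_neg, dotProduct_add, add_dotProduct,
      neg_dotProduct, dotProduct_neg, hself, hea, hee, hv, ha]
    simp only [embW, embH, Pi.neg_apply, Pi.zero_apply]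
    ring

theorem abs_le_dW_of_eq_add_single {m n : ℕ} (b : Fin n → Matrix (Fin m) (Fin m) ℝ)
    {A B : W m n 1} {j : Fin (m - 1)} {t : ℝ} (hB : B.1 = A.1 + Pi.single j t) :
    |t| ≤ dW m n 1 b A B := by
  have h : (gmul b (ginv (embW m n 1 A)) (embW m n 1 B)).1 = Pi.single (idx1 m j) t := by
    simp [gmul, ginv, embW_fst_eq_add_single hB]
  rw [dW, qnorm, h, enorm_single]
  exact le_add_of_nonneg_right (Real.sqrt_nonneg _)

theorem dW_self {m n : ℕ} (b : Fin n → Matrix (Fin m) (Fin m) ℝ)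
    (hskew : ∀ s, (b s).transpose = -(b s)) (A : W m n 1) : dW m n 1 b A A = 0 := by
  have h : gmul b (ginv (embW m n 1 A)) (embW m n 1 A) = 0 := by
    rw [gmul_eq]
    refine Prod.ext (by simp [ginv]) (funext fun s => ?_)
    have := dotProduct_mulVec_comm_of_skew (hskew s) (embW m n 1 A).1 (embW m n 1 A).1
    simp only [ginv, Matrix.mulVec_neg, dotProduct_neg, Pi.neg_apply, Prod.snd_zero,
      Pi.zero_apply]
    linarith
  simp [dW, h, qnorm, enorm]

theorem continuous_dW {m n : ℕ} (b : Fin n → Matrix (Fin m) (Fin m) ℝ) (A : W m n 1) :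
    Continuous (dW m n 1 b A) := by
  have hfst (i : Fin m) : Continuous fun B : W m n 1 => (embW m n 1 B).1 i := by
    by_cases h : (i : ℕ) < 1
    · simpa only [embW, h, dite_true] using continuous_const
    · simp only [embW, h, dite_false]
      fun_prop
  have hsnd (s : Fin n) : Continuous fun B : W m n 1 => (embW m n 1 B).2 s := by
    simp only [embW]
    fun_prop
  refine (continuous_enorm.comp (continuous_pi fun i => ?_)).add
    (continuous_enorm.comp (continuous_pi fun s => ?_)).sqrt
  · exact continuous_const.add (hfst i)
  · exact (continuous_const.add (hsnd s)).add (continuous_const.mul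
      (continuous_finsetSum _ fun i _ => continuous_finsetSum _ fun k _ =>
        continuous_const.mul (hfst i)))

/-- A function vanishing at `0` whose derivative is `O(t)` is `O(t²)`. -/
theorem isBigO_sq_of_hasDerivAt {f f' : ℝ → ℝ} (h0 : f 0 = 0)
    (hf : ∀ᶠ t in 𝓝 (0 : ℝ), HasDerivAt f (f' t) t) (hf' : f' =O[𝓝 0] fun t => t) :
    f =O[𝓝 0] fun t => t ^ 2 := by
  obtain ⟨K, hK, hbound⟩ := hf'.exists_nonneg
  obtain ⟨ε, hε, hball⟩ := Metric.eventually_nhds_iff_ball.mp (hf.and hbound.bound)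
  refine Asymptotics.IsBigO.of_bound K ?_
  filter_upwards [Metric.ball_mem_nhds (0 : ℝ) hε] with t ht
  have hsub : ∀ u ∈ Metric.closedBall (0 : ℝ) |t|, u ∈ Metric.ball (0 : ℝ) ε := fun u hu => by
    simp only [Metric.mem_closedBall, Metric.mem_ball, dist_zero_right, Real.norm_eq_abs] at *
    exact hu.trans_lt ht
  have := (convex_closedBall (0 : ℝ) |t|).norm_image_sub_le_of_norm_hasDerivWithin_le
    (fun u hu => (hball u (hsub u hu)).1.hasDerivWithinAt) (C := K * |t|)
    (fun u hu => (hball u (hsub u hu)).2.trans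
      (mul_le_mul_of_nonneg_left (by simpa using hu) hK))
    (Metric.mem_closedBall_self (abs_nonneg t)) (y := t) (by simp)
  simpa [h0, sq, mul_assoc] using this

/-- A function on `[-δ, δ]` with constant derivative `c` is affine. -/
theorem eq_add_mul_of_hasDerivAt_const {f : ℝ → ℝ} {c δ : ℝ}
    (hf : ∀ t ∈ Set.Icc (-δ) δ, HasDerivAt f c t) {t : ℝ} (ht : t ∈ Set.Icc (-δ) δ) :
    f t = f 0 + c * t := by
  have h0 : (0 : ℝ) ∈ Set.Icc (-δ) δ := ⟨by linarith [ht.1, ht.2], by linarith [ht.1, ht.2]⟩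
  have := (convex_Icc (-δ) δ).norm_image_sub_le_of_norm_hasDerivWithin_le (C := 0)
    (f := fun u => f u - c * u) (f' := fun _ => 0)
    (fun u hu => by
      simpa [Pi.sub_def] using
        ((hf u hu).sub ((hasDerivAt_id u).const_mul c)).hasDerivWithinAt)
    (fun u _ => by simp) h0 ht
  simp only [mul_zero, sub_zero, zero_mul, norm_le_zero_iff] at this
  linarith

/-- Along an integral curve `γ` of the vector field `D_j^ψ`
through `A`, if `ψ` is u.i.d. at `A` with intrinsic gradient `g` and `t ↦ ψ(γ(t))`
is `C¹`, then the derivative of `ψ ∘ γ` at `0` is the `j`-th component of the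
intrinsic gradient. -/
theorem statement10 (m n : ℕ) (hm : 2 ≤ m) (hn : 1 ≤ n)
    (b : Fin n → Matrix (Fin m) (Fin m) ℝ)
    (hskew : ∀ s, (b s).transpose = -(b s)) (hind : LinearIndependent ℝ b)
    (O : Set (W m n 1)) (hO : IsOpen O) (A : W m n 1) (hA : A ∈ O)
    (ψ : W m n 1 → ℝ) (j : Fin (m - 1)) (δ : ℝ) (hδ : 0 < δ)
    (γ : ℝ → W m n 1)
    (hmaps : ∀ t ∈ Set.Icc (-δ) δ, γ t ∈ O)
    (hγ0 : γ 0 = A)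
    (hx : ∀ h : Fin (m - 1), ∀ t ∈ Set.Icc (-δ) δ,
      HasDerivAt (fun t' => (γ t').1 h) (if h = j then 1 else 0) t)
    (hy : ∀ s : Fin n, ∀ t ∈ Set.Icc (-δ) δ,
      HasDerivAt (fun t' => (γ t').2 s)
        (ψ (γ t) * b s (idx1 m j) ⟨0, by omega⟩ +
          (1 / 2) * ∑ l, (γ t).1 l * b s (idx1 m j) (idx1 m l)) t)
    (hψγ : ContDiffOn ℝ 1 (fun t => ψ (γ t)) (Set.Icc (-δ) δ))
    (g : Fin (m - 1) → ℝ) (huid : UIDs m n b O ψ A g) :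
    Filter.Tendsto (fun t => (ψ (γ t) - ψ A) / t) (𝓝[≠] (0:ℝ)) (𝓝 (g j)) := by
  have h0 : 0 < m := by omega
  have hnhds : Set.Icc (-δ) δ ∈ 𝓝 (0 : ℝ) := Icc_mem_nhds (by linarith) hδ
  have hfst : ∀ t ∈ Set.Icc (-δ) δ, (γ t).1 = A.1 + Pi.single j t := fun t ht => by
    funext h
    rw [eq_add_mul_of_hasDerivAt_const (hx h) ht, hγ0]
    by_cases hj : h = j <;> simp [hj]
  have hψO : (fun t => ψ (γ t) - ψ A) =O[𝓝 0] fun t : ℝ => t := by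
    simpa [hγ0] using ((hψγ.contDiffAt hnhds).differentiableAt one_ne_zero).isBigO_sub
  let c (s : Fin n) : ℝ := ψ A * b s (idx1 m j) ⟨0, h0⟩ +
    (1 / 2) * ∑ l, A.1 l * b s (idx1 m j) (idx1 m l)
  let Y (t : ℝ) (s : Fin n) : ℝ := (γ t).2 s - A.2 s - t * c s
  have hY (s : Fin n) : (fun t => Y t s) =O[𝓝 0] fun t : ℝ => t ^ 2 := by
    refine isBigO_sq_of_hasDerivAt
      (f' := fun t => b s (idx1 m j) ⟨0, h0⟩ * (ψ (γ t) - ψ A)) (by simp [Y, hγ0]) ?_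
      (hψO.const_mul_left _)
    filter_upwards [hnhds] with t ht
    have hdiag : b s (idx1 m j) (idx1 m j) = 0 := by
      have := congrFun (congrFun (hskew s) (idx1 m j)) (idx1 m j)
      simp only [Matrix.transpose_apply, Matrix.neg_apply] at this
      linarith
    have hsum : ∑ l, (γ t).1 l * b s (idx1 m j) (idx1 m l) =
        ∑ l, A.1 l * b s (idx1 m j) (idx1 m l) := by
      simp [hfst t ht, add_mul, Finset.sum_add_distrib, Pi.single_apply, hdiag]
    refine (((hy s t ht).sub_const (A.2 s)).sub
      ((hasDerivAt_id t).mul_const (c s))).congr_deriv ?_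
    rw [hsum]
    simp only [c]
    ring
  obtain ⟨K, -, hK⟩ : ∃ K > 0, ∀ᶠ t in 𝓝 (0 : ℝ), ‖∑ s, |Y t s|‖ ≤ K * ‖t ^ 2‖ :=
    (Asymptotics.IsBigO.sum (s := Finset.univ) fun s _ => (hY s).abs_left).exists_pos.imp
      fun K h => ⟨h.1, by simpa only [Finset.sum_apply] using h.2.bound⟩
  have hγcont : ContinuousAt γ 0 :=
    ContinuousAt.prodMk
      (continuousAt_pi.mpr fun h => (hx h 0 (mem_of_mem_nhds hnhds)).continuousAt)
      (continuousAt_pi.mpr fun s => (hy s 0 (mem_of_mem_nhds hnhds)).continuousAt)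
  have hdW : Tendsto (fun t => dW m n 1 b A (γ t)) (𝓝 0) (𝓝 0) := by
    simpa [hγ0, dW_self b hskew, ContinuousAt, Function.comp_def] using
      (continuous_dW b A).continuousAt.comp hγcont
  have hderiv : HasDerivAt (fun t => ψ (γ t)) (g j) 0 := by
    refine HasDerivAt.of_isLittleO (Asymptotics.IsLittleO.of_bound fun ε hε => ?_)
    have hC : 0 < 1 + √K := by positivity
    obtain ⟨r, hr, huid⟩ := huid (ε / (1 + √K)) (div_pos hε hC)
    filter_upwards [hnhds, hK, hdW.eventually_lt_const hr] with t ht hKt hrt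
    rcases eq_or_ne t 0 with rfl | ht0
    · simp
    have hσ : sigma m n 1 b (fun A' _ => ψ A') A (γ t) ≤ (1 + √K) * |t| := by
      have hsqrt : √(enorm (Y t)) ≤ √K * |t| := by
        rw [← Real.sqrt_sq_eq_abs, ← Real.sqrt_mul' K (sq_nonneg t)]
        refine Real.sqrt_le_sqrt ((enorm_le_sum_abs _).trans ((le_abs_self _).trans ?_))
        simpa using hKt
      rw [sigma_of_eq_add_single h0 b hskew ψ (hfst t ht)]
      linarith
    have := huid A hA (γ t) (hmaps t ht) (by rwa [dW_self b hskew]) hrt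
      ((abs_pos.mpr ht0).trans_le (abs_le_dW_of_eq_add_single b (hfst t ht)))
    have hlin : ∑ i, g i * ((γ t).1 i - A.1 i) = t * g j := by
      simp [hfst t ht, Pi.single_apply, mul_comm]
    rw [hlin] at this
    simp only [hγ0, sub_zero, smul_eq_mul, Real.norm_eq_abs]
    refine this.trans ((mul_le_mul_of_nonneg_left hσ (by positivity)).trans_eq ?_)
    field_simp
  simpa [hγ0, div_eq_inv_mul] using hasDerivAt_iff_tendsto_slope_zero.mp hderiv

end Carnot
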